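/- arXiv:1510.05016 — 2 statements merged into one kernel-verified Lean document; each statement's English description precedes it below -/
import Mathlib

section
/- Let K be an algebraically closed field of characteristic 0, let f ∈ K[x] be a disintegrated polynomial, and let N ≥ 4 be an integer. Assume there are coprime integers s > 0 and n > 1 and a non-constant polynomial P ∈ K[x] with P(0) ≠ 0 such that f^{∘N}(x) = x^s P(x)^n. Then there exist a positive integer s̃ and a non-constant polynomial P_1 ∈ K[x] with P_1(0) ≠ 0 such that f^{∘4}(x) = x^{s̃} P_1(x)^n. -/
open Polynomial

/-- The Chebyshev polynomial `T_n` satisfying `T_n(x + 1/x) = x^n + 1/x^n`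
(the Dickson polynomial of the first kind with parameter 1). -/
noncomputable def cheb (K : Type*) [CommRing K] (n : ℕ) : K[X] :=
  Polynomial.dickson 1 1 n

/-- The `n`-fold compositional iterate of a polynomial. -/
noncomputable def polyIter {K : Type*} [CommRing K] (f : K[X]) : ℕ → K[X]
  | 0 => X
  | n + 1 => f.comp (polyIter f n)

/-- `f` is linearly conjugate to `g`, i.e. `f = ℓ ∘ g ∘ ℓ⁻¹` for a degree-1 polynomial `ℓ`. -/
def LinConj {K : Type*} [CommRing K] (f g : K[X]) : Prop :=
  ∃ ℓ ℓi : K[X], ℓ.degree = 1 ∧ ℓi.degree = 1 ∧ ℓ.comp ℓi = X ∧ ℓi.comp ℓ = X ∧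
    f = ℓ.comp (g.comp ℓi)

/-- A polynomial is disintegrated if it has degree `δ ≥ 2` and is not linearly conjugate
to `x^δ` or `±T_δ(x)`. -/
def Disintegrated {K : Type*} [CommRing K] (f : K[X]) : Prop :=
  2 ≤ f.natDegree ∧ ¬ LinConj f (X ^ f.natDegree) ∧
    ¬ LinConj f (cheb K f.natDegree) ∧ ¬ LinConj f (-(cheb K f.natDegree))

/-- `η` (of degree at least 2) is semiconjugate to `f` if `f ∘ p = p ∘ η` for some
non-constant polynomial `p`. -/
def SemiconjTo {K : Type*} [CommRing K] (η f : K[X]) : Prop :=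
  ∃ p : K[X], 0 < p.natDegree ∧ f.comp p = p.comp η

/-- `f ≈ g`: there exist `N ≥ 1` and a polynomial `η` (of degree at least 2) semiconjugate
to both `f^{∘N}` and `g^{∘N}`. -/
def PolyApprox {K : Type*} [CommRing K] (f g : K[X]) : Prop :=
  ∃ N : ℕ, 1 ≤ N ∧ ∃ η : K[X], 2 ≤ η.natDegree ∧
    SemiconjTo η (polyIter f N) ∧ SemiconjTo η (polyIter g N)

section Helpers

variable {K : Type*} [Field K]

/-- Local multiplicity of `g` at `z`. -/
noncomputable def locMult (g : K[X]) (z : K) : ℕ := (g - C (g.eval z)).rootMultiplicity z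

lemma sub_C_ne_zero_of_pos {g : K[X]} (hg : 0 < g.natDegree) (a : K) : g - C a ≠ 0 := by
  intro h
  have := natDegree_sub_C (p := g) (a := a)
  rw [h, natDegree_zero] at this
  omega

lemma rootMultiplicity_pow_aux (p : K[X]) (hp : p ≠ 0) (z : K) (k : ℕ) :
    (p ^ k).rootMultiplicity z = k * p.rootMultiplicity z := by
  classical
  rw [← count_roots, ← count_roots, roots_pow, Multiset.count_nsmul]

lemma locMult_pos {g : K[X]} (hg : 0 < g.natDegree) (z : K) : 0 < locMult g z := by
  unfold locMult
  rw [rootMultiplicity_pos (sub_C_ne_zero_of_pos hg _)]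
  simp

lemma locMult_comp (f g : K[X]) (hf : 0 < f.natDegree) (hg : 0 < g.natDegree) (z : K) :
    locMult (f.comp g) z = locMult f (g.eval z) * locMult g z := by
  set b := g.eval z with hb
  obtain ⟨H, hH, hnd⟩ := exists_eq_pow_rootMultiplicity_mul_and_not_dvd (f - C (f.eval b))
    (sub_C_ne_zero_of_pos hf _) b
  have hHb : H.eval b ≠ 0 := by
    rwa [dvd_iff_isRoot] at hnd
  have key : f.comp g - C ((f.comp g).eval z) = (g - C b) ^ (locMult f b) * H.comp g := by
    have := congrArg (fun p => p.comp g) hH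
    simpa [eval_comp, ← hb, locMult] using this
  have hgb : g - C b ≠ 0 := sub_C_ne_zero_of_pos hg _
  have hHg : (H.comp g).eval z ≠ 0 := by rw [eval_comp]; exact hHb
  have hHg0 : H.comp g ≠ 0 := by
    intro h0; rw [h0] at hHg; simp at hHg
  change rootMultiplicity z (f.comp g - C ((f.comp g).eval z)) = _
  rw [key, rootMultiplicity_mul (mul_ne_zero (pow_ne_zero _ hgb) hHg0),
    rootMultiplicity_pow_aux _ hgb, rootMultiplicity_eq_zero (p := H.comp g) hHg]
  simp [locMult, ← hb]

open Classical in
/-- Fiber of `g` over `a`. -/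
noncomputable def fib (g : K[X]) (a : K) : Finset K := (g - C a).roots.toFinset

lemma mem_fib {g : K[X]} (hg : 0 < g.natDegree) (a z : K) : z ∈ fib g a ↔ g.eval z = a := by
  classical
  simp [fib, sub_C_ne_zero_of_pos hg, sub_eq_zero]

lemma fib_sum [IsAlgClosed K] {g : K[X]} (hg : 0 < g.natDegree) (a : K) :
    ∑ z ∈ fib g a, locMult g z = g.natDegree := by
  classical
  rw [← natDegree_sub_C (a := a), (IsAlgClosed.splits (g - C a)).natDegree_eq_card_roots,
    ← Multiset.toFinset_sum_count_eq]
  have : fib g a = (g - C a).roots.toFinset := by unfold fib; congr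
  rw [← this]
  refine Finset.sum_congr rfl fun z hz => ?_
  rw [mem_fib hg] at hz
  rw [count_roots, locMult, hz]

lemma rh [CharZero K] {g : K[X]} (hg : 0 < g.natDegree) (A : Finset K) :
    ∑ a ∈ A, ∑ z ∈ fib g a, (locMult g z - 1) < g.natDegree := by
  classical
  rw [← Finset.sum_biUnion]
  · have h1 : ∀ z, locMult g z - 1 = (derivative g).roots.count z := by
      intro z
      have hr : (g - C (g.eval z)).IsRoot z := by simp
      have := derivative_rootMultiplicity_of_root hr
      rw [count_roots, locMult, ← this]
      simp
    calc ∑ z ∈ A.biUnion (fib g), (locMult g z - 1)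
        = ∑ z ∈ A.biUnion (fib g), (derivative g).roots.count z :=
          Finset.sum_congr rfl fun z _ => h1 z
      _ ≤ ∑ z ∈ A.biUnion (fib g) ∪ (derivative g).roots.toFinset,
            (derivative g).roots.count z :=
          Finset.sum_le_sum_of_subset Finset.subset_union_left
      _ = (derivative g).roots.card := by
          apply Multiset.sum_count_eq_card
          intro a ha
          simp only [Finset.mem_union, Multiset.mem_toFinset]
          exact Or.inr ha
      _ ≤ (derivative g).natDegree := card_roots' _
      _ < g.natDegree := natDegree_derivative_lt hg.ne'
  · intro a _ b _ hab
    rw [Function.onFun, Finset.disjoint_left]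
    intro z hz hz'
    rw [mem_fib hg] at hz hz'
    exact hab (hz.symm.trans hz')

lemma fiber_two [IsAlgClosed K] {g : K[X]} (hg : 0 < g.natDegree) (a : K)
    (h : ∀ z, g.eval z = a → 2 ≤ locMult g z) :
    g.natDegree ≤ 2 * ∑ z ∈ fib g a, (locMult g z - 1) := by
  rw [← fib_sum hg a, Finset.mul_sum]
  refine Finset.sum_le_sum fun z hz => ?_
  have := h z ((mem_fib hg a z).1 hz)
  omega

lemma fiber_one [IsAlgClosed K] {g : K[X]} (hg : 0 < g.natDegree) (a z0 : K)
    (h : ∀ z, z ≠ z0 → g.eval z = a → 2 ≤ locMult g z) :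
    g.natDegree ≤ 2 * ∑ z ∈ fib g a, (locMult g z - 1) + 1 := by
  classical
  calc g.natDegree = ∑ z ∈ fib g a, locMult g z := (fib_sum hg a).symm
    _ ≤ ∑ z ∈ fib g a, (2 * (locMult g z - 1) + if z = z0 then 1 else 0) := by
        refine Finset.sum_le_sum fun z hz => ?_
        have h1 := locMult_pos hg z
        split_ifs with hz0
        · omega
        · have := h z hz0 ((mem_fib hg a z).1 hz)
          omega
    _ ≤ _ := by
        rw [Finset.sum_add_distrib, Finset.mul_sum, Finset.sum_ite_eq']
        split_ifs <;> omega

/-- All points of the fiber of `g` through `b` other than `b` have multiplicity divisible by `n`,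
and `b` has multiplicity coprime to `n`. -/
def GoodAt (n : ℕ) (g : K[X]) (b : K) : Prop :=
  Nat.Coprime (locMult g b) n ∧ ∀ z, z ≠ b → g.eval z = g.eval b → n ∣ locMult g z

lemma two_le_of_dvd {n : ℕ} (hn : 1 < n) {g : K[X]} (hg : 0 < g.natDegree) {z : K}
    (h : n ∣ locMult g z) : 2 ≤ locMult g z :=
  hn.trans_le (Nat.le_of_dvd (locMult_pos hg z) h)

lemma good_comp [IsAlgClosed K] [CharZero K] {n : ℕ} (hn : 1 < n) {f g : K[X]}
    (hf : 0 < f.natDegree) (hg : 0 < g.natDegree) {w : K} (h : GoodAt n (f.comp g) w) :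
    GoodAt n g w ∧ GoodAt n f (g.eval w) := by
  classical
  obtain ⟨h1, h2⟩ := h
  rw [locMult_comp f g hf hg] at h1
  have c1 : Nat.Coprime (locMult f (g.eval w)) n := Nat.Coprime.coprime_mul_right h1
  have c2 : Nat.Coprime (locMult g w) n := Nat.Coprime.coprime_mul_left h1
  have hgood : ∀ z, z ≠ w → g.eval z = g.eval w → n ∣ locMult g z := by
    intro z hz hzw
    have := h2 z hz (by simp [eval_comp, hzw])
    rw [locMult_comp f g hf hg, hzw] at this
    exact c1.symm.dvd_of_dvd_mul_left this
  refine ⟨⟨c2, hgood⟩, c1, ?_⟩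
  intro b hb hfb
  by_contra hnd
  have hall : ∀ z, g.eval z = b → 2 ≤ locMult g z := by
    intro z hz
    have hzw : z ≠ w := by
      rintro rfl; exact hb hz.symm
    have := h2 z hzw (by simp [eval_comp, hz, hfb])
    rw [locMult_comp f g hf hg, hz] at this
    have hp := locMult_pos hg z
    by_contra hlt
    have : locMult g z = 1 := by omega
    simp_all
  have A := fiber_two hg b hall
  have B := fiber_one hg (g.eval w) w fun z hz hzw => two_le_of_dvd hn hg (hgood z hz hzw)
  have R := rh hg {b, g.eval w}
  rw [Finset.sum_pair hb] at R
  omega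

lemma exists_nth_root [IsAlgClosed K] {n : ℕ} (hn : 0 < n) (g : K[X])
    (h : ∀ z, n ∣ g.rootMultiplicity z) : ∃ P : K[X], g = P ^ n := by
  classical
  obtain ⟨c, hc⟩ := IsAlgClosed.exists_pow_nat_eq g.leadingCoeff hn
  refine ⟨C c * ∏ a ∈ g.roots.toFinset, (X - C a) ^ (g.rootMultiplicity a / n), ?_⟩
  conv_lhs => rw [(IsAlgClosed.splits g).eq_prod_roots, Finset.prod_multiset_map_count]
  rw [mul_pow, ← C_pow, hc, ← Finset.prod_pow]
  congr 1
  refine Finset.prod_congr rfl fun a _ => ?_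
  rw [← pow_mul, Nat.div_mul_cancel (h a), count_roots]

lemma polyIter_eval (f : K[X]) (k : ℕ) (x : K) :
    (polyIter f k).eval x = (fun y => f.eval y)^[k] x := by
  induction k with
  | zero => simp [polyIter]
  | succ k ih => rw [Function.iterate_succ_apply', ← ih, polyIter, eval_comp]

lemma polyIter_natDegree_pos (f : K[X]) (hf : 0 < f.natDegree) (k : ℕ) :
    0 < (polyIter f k).natDegree := by
  induction k with
  | zero => simp [polyIter]
  | succ k ih => rw [polyIter, natDegree_comp]; positivity

lemma good_iter [IsAlgClosed K] [CharZero K] {n : ℕ} (hn : 1 < n) {f : K[X]}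
    (hf : 0 < f.natDegree) (N : ℕ) (h : GoodAt n (polyIter f N) 0) :
    ∀ k, k ≤ N → GoodAt n (polyIter f k) 0 := by
  induction N with
  | zero => intro k hk; rwa [Nat.le_zero.1 hk]
  | succ N ih =>
    intro k hk
    rcases Nat.lt_or_ge N k with h1 | h1
    · rwa [show k = N + 1 by omega]
    · exact ih (good_comp hn hf (polyIter_natDegree_pos f hf N) h).1 k h1

end Helpers

/-- If `f` is disintegrated, `N ≥ 4`, and `f^{∘N} = x^s P(x)ⁿ` with `gcd(s,n) = 1`, `s > 0`,
`n > 1`, `P` non-constant and `P(0) ≠ 0`, then `f^{∘4} = x^s̃ P₁(x)ⁿ` for some `s̃ > 0` and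
some non-constant `P₁` with `P₁(0) ≠ 0`. -/
theorem fourth_iterate_xsPn {K : Type*} [Field K] [IsAlgClosed K] [CharZero K]
    (f : K[X]) (hf : Disintegrated f) (N : ℕ) (hN : 4 ≤ N)
    (s n : ℕ) (hs : 0 < s) (hn : 1 < n) (hcop : Nat.Coprime s n)
    (P : K[X]) (hP : 0 < P.natDegree) (hP0 : P.eval 0 ≠ 0)
    (h : polyIter f N = (X : K[X]) ^ s * P ^ n) :
    ∃ (s' : ℕ) (P₁ : K[X]), 0 < s' ∧ 0 < P₁.natDegree ∧ P₁.eval 0 ≠ 0 ∧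
      polyIter f 4 = (X : K[X]) ^ s' * P₁ ^ n := by
  have hd : 2 ≤ f.natDegree := hf.1
  have hfp : 0 < f.natDegree := by omega
  have hPne : P ≠ 0 := by
    rintro rfl; simp at hP
  have hX : (X : K[X]) ^ s ≠ 0 := pow_ne_zero _ X_ne_zero
  have hev : (polyIter f N).eval 0 = 0 := by
    rw [h]; simp [hs.ne']
  have hmult : ∀ z, (polyIter f N).rootMultiplicity z
      = s * (X : K[X]).rootMultiplicity z + n * P.rootMultiplicity z := by
    intro z
    rw [h, rootMultiplicity_mul (mul_ne_zero hX (pow_ne_zero _ hPne)),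
      rootMultiplicity_pow_aux _ X_ne_zero, rootMultiplicity_pow_aux _ hPne]
  have hX0 : (X : K[X]).rootMultiplicity 0 = 1 := by
    have := rootMultiplicity_X_sub_C_self (x := (0 : K))
    simpa using this
  have hXz : ∀ z : K, z ≠ 0 → (X : K[X]).rootMultiplicity z = 0 := by
    intro z hz
    exact rootMultiplicity_eq_zero (by simpa using hz)
  have hgoodN : GoodAt n (polyIter f N) 0 := by
    refine ⟨?_, ?_⟩
    · rw [locMult, hev, map_zero, sub_zero, hmult, hX0, rootMultiplicity_eq_zero (p := P) hP0]
      simpa using hcop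
    · intro z hz hz0
      rw [locMult, hz0, hev, map_zero, sub_zero, hmult, hXz z hz]
      simp
  have hgood := good_iter hn hfp N hgoodN
  have hgf : ∀ k, k + 1 ≤ N → GoodAt n f ((polyIter f k).eval 0) := fun k hk =>
    (good_comp hn hfp (polyIter_natDegree_pos f hfp k) (hgood (k + 1) hk)).2
  set F : K → K := fun y => f.eval y with hF
  have hFN : F^[N] 0 = 0 := by rw [← polyIter_eval]; exact hev
  have hB : ∀ k, k + 1 ≤ N →
      f.natDegree ≤ 2 * ∑ z ∈ fib f (F^[k + 1] 0), (locMult f z - 1) + 1 := by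
    intro k hk
    refine fiber_one hfp _ (F^[k] 0) fun z hz hzk => ?_
    have := (hgf k hk).2 z
    rw [polyIter_eval] at this
    rw [Function.iterate_succ_apply'] at hzk
    exact two_le_of_dvd hn hfp (this hz hzk)
  have hF4 : F^[4] 0 = 0 := by
    have push : ∀ i p, i ≤ N → F^[i] 0 = F^[p + i] 0 → F^[p] 0 = 0 := by
      intro i p hi hip
      have h1 := congrArg F^[N - i] hip
      rw [← Function.iterate_add_apply, ← Function.iterate_add_apply,
        show N - i + i = N by omega, show N - i + (p + i) = p + N by omega,
        Function.iterate_add_apply F p N, hFN] at h1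
      exact h1.symm
    have one : F^[1] 0 = 0 → F^[4] 0 = 0 := by
      intro h1
      rw [show 4 = 1 * 4 by rfl, Function.iterate_mul]
      exact Function.iterate_fixed h1 4
    by_cases h12 : F^[1] 0 = F^[2] 0
    · exact one (push 1 1 (by omega) h12)
    by_cases h23 : F^[2] 0 = F^[3] 0
    · exact one (push 2 1 (by omega) h23)
    by_cases h13 : F^[1] 0 = F^[3] 0
    · have h2 := push 1 2 (by omega) h13
      rw [show 4 = 2 * 2 by rfl, Function.iterate_mul]
      exact Function.iterate_fixed h2 2
    exfalso
    classical
    have R := rh hfp {F^[1] 0, F^[2] 0, F^[3] 0}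
    rw [Finset.sum_insert (by simp only [Finset.mem_insert, Finset.mem_singleton]; tauto),
      Finset.sum_pair h23] at R
    have b1 := hB 0 (by omega)
    have b2 := hB 1 (by omega)
    have b3 := hB 2 (by omega)
    simp only [Nat.reduceAdd] at b1 b2 b3
    omega
  have h40 : (polyIter f 4).eval 0 = 0 := by rw [polyIter_eval]; exact hF4
  obtain ⟨g1, g2⟩ := hgood 4 hN
  have hdeg4 := polyIter_natDegree_pos f hfp 4
  have hp0 := locMult_pos hdeg4 (0 : K)
  set G := polyIter f 4 with hG
  have hG0 : G ≠ 0 := by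
    intro h0; rw [h0] at hdeg4; simp at hdeg4
  obtain ⟨H, hH, hnd⟩ := exists_eq_pow_rootMultiplicity_mul_and_not_dvd G hG0 0
  have hH0 : H.eval 0 ≠ 0 := by rwa [dvd_iff_isRoot] at hnd
  rw [locMult, h40, map_zero, sub_zero] at hp0
  set s' := G.rootMultiplicity 0 with hs'
  rw [map_zero, sub_zero] at hH
  have hHne : H ≠ 0 := by
    rintro rfl; simp at hH0
  have hdiv : ∀ z, n ∣ H.rootMultiplicity z := by
    intro z
    by_cases hz : z = 0
    · rw [hz, rootMultiplicity_eq_zero (p := H) hH0]; exact dvd_zero _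
    by_cases hGz : G.eval z = 0
    · have h1 := g2 z hz (hGz.trans h40.symm)
      rw [locMult, hGz, map_zero, sub_zero, hH,
        rootMultiplicity_mul (mul_ne_zero (pow_ne_zero _ X_ne_zero) hHne),
        rootMultiplicity_pow_aux _ X_ne_zero, hXz z hz] at h1
      simpa using h1
    · have : ¬ H.IsRoot z := by
        intro hr
        apply hGz
        rw [hH, eval_mul, hr.eq_zero, mul_zero]
      rw [rootMultiplicity_eq_zero this]; exact dvd_zero _
  obtain ⟨P₁, hP₁⟩ := exists_nth_root (by omega) H hdiv
  have hP10 : P₁.eval 0 ≠ 0 := by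
    intro h0
    apply hH0
    rw [hP₁, eval_pow, h0, zero_pow (by omega)]
  refine ⟨s', P₁, hp0, ?_, hP10, hP₁ ▸ hH⟩
  by_contra hc
  have hconst : P₁ = C (P₁.coeff 0) := eq_C_of_natDegree_eq_zero (by omega)
  have hinv : ∀ w, F^[4] w = 0 → w = 0 := by
    intro w hw
    rw [← polyIter_eval, ← hG, hH, hP₁, eval_mul, eval_pow, eval_pow, eval_X] at hw
    have hne : P₁.eval w ≠ 0 := by
      rw [hconst, eval_C]
      rw [hconst, eval_C] at hP10
      exact hP10
    rcases mul_eq_zero.1 hw with h1 | h1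
    · exact eq_zero_of_pow_eq_zero h1
    · exact absurd (eq_zero_of_pow_eq_zero h1) hne
  have hinv' : ∀ k w, (F^[4])^[k] w = 0 → w = 0 := by
    intro k
    induction k with
    | zero => intro w hw; simpa using hw
    | succ k ih =>
      intro w hw
      rw [Function.iterate_succ_apply] at hw
      exact hinv w (ih _ hw)
  obtain ⟨z, hz⟩ := IsAlgClosed.exists_root P (by
    rw [degree_eq_natDegree hPne]; exact_mod_cast hP.ne')
  have hNz : F^[N] z = 0 := by
    rw [← polyIter_eval, h, eval_mul, eval_pow, eval_pow, hz.eq_zero, zero_pow (by omega), mul_zero]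
  have h4N : (F^[4])^[N] z = 0 := by
    rw [← Function.iterate_mul, mul_comm, Function.iterate_mul,
      Function.iterate_succ_apply, hNz]
    exact Function.iterate_fixed hFN 3
  have := hinv' N z h4N
  rw [this] at hz
  exact hP0 hz
end

section
/- Let K be an algebraically closed field of characteristic 0 and let A, B ∈ K[x] be non-constant polynomials. If the composition A ∘ B is disintegrated, then B ∘ A is disintegrated. -/
open Polynomial

lemma aux_decomp {K : Type*} [Field K] [CharZero K] (A E B D : K[X])
    (hA : 0 < A.natDegree) (hd : E.natDegree = A.natDegree)
    (hl : E.leadingCoeff = A.leadingCoeff) (hB : 0 < B.natDegree)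
    (h : B.comp A = D.comp E) : (A - E).natDegree = 0 := by
  by_cases hE : A - E = 0
  · simp [hE]
  have hA0 : A ≠ 0 := by rintro rfl; simp at hA
  have hB0 : B ≠ 0 := by rintro rfl; simp at hB
  have hE0 : E ≠ 0 := by rintro rfl; simp at hd; omega
  have hDd : D.natDegree = B.natDegree := by
    have := congrArg natDegree h
    rw [natDegree_comp, natDegree_comp, hd] at this
    exact (Nat.eq_of_mul_eq_mul_right hA this).symm
  have hDl : D.leadingCoeff = B.leadingCoeff := by
    have := congrArg leadingCoeff h
    rw [leadingCoeff_comp hA.ne', leadingCoeff_comp (by omega), hl, hDd] at this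
    exact (mul_right_cancel₀ (pow_ne_zero _ (by simpa using hA0)) this).symm
  obtain ⟨b, hb⟩ : ∃ b, B.natDegree = b + 1 := ⟨B.natDegree - 1, by omega⟩
  set S : K[X] := ∑ i ∈ Finset.range (b + 1), A ^ i * E ^ (b + 1 - 1 - i) with hS
  have hcoef : S.coeff (b * A.natDegree) = (b + 1 : ℕ) * A.leadingCoeff ^ b := by
    rw [hS, finsetSum_coeff, Finset.sum_congr rfl (g := fun _ => A.leadingCoeff ^ b)]
    · simp
    intro i hi
    have hi' : i ≤ b := by simpa [Nat.lt_succ_iff] using hi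
    have h1 : b * A.natDegree = (A ^ i * E ^ (b + 1 - 1 - i)).natDegree := by
      rw [natDegree_mul (pow_ne_zero _ hA0) (pow_ne_zero _ hE0), natDegree_pow, natDegree_pow, hd,
        ← add_mul]
      congr 1; omega
    rw [h1, coeff_natDegree, leadingCoeff_mul, leadingCoeff_pow, leadingCoeff_pow, hl, ← pow_add]
    congr 1; omega
  have hcne : S.coeff (b * A.natDegree) ≠ 0 := by
    rw [hcoef]
    exact mul_ne_zero (by exact_mod_cast Nat.succ_ne_zero b)
      (pow_ne_zero _ (by simpa using hA0))
  have hSd := le_natDegree_of_ne_zero hcne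
  have hS0 : S ≠ 0 := by intro h0; rw [h0] at hcne; simp at hcne
  have hg : S * (A - E) = A ^ (b + 1) - E ^ (b + 1) := geom_sum₂_mul A E (b + 1)
  have e1 : B.comp A = B.eraseLead.comp A + C B.leadingCoeff * A ^ (b + 1) := by
    conv_lhs => rw [← eraseLead_add_C_mul_X_pow B]
    simp [hb]
  have e2 : D.comp E = D.eraseLead.comp E + C B.leadingCoeff * E ^ (b + 1) := by
    conv_lhs => rw [← eraseLead_add_C_mul_X_pow D]
    simp [hb, hDl, hDd]
  have key : C B.leadingCoeff * (S * (A - E)) = D.eraseLead.comp E - B.eraseLead.comp A := by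
    rw [hg]
    rw [e1, e2] at h
    linear_combination h
  have d1 : (D.eraseLead.comp E - B.eraseLead.comp A).natDegree ≤ b * A.natDegree := by
    refine (natDegree_sub_le _ _).trans (max_le ?_ ?_)
    · rw [natDegree_comp, hd]
      refine Nat.mul_le_mul_right _ ((eraseLead_natDegree_le D).trans (by omega))
    · rw [natDegree_comp]
      refine Nat.mul_le_mul_right _ ((eraseLead_natDegree_le B).trans (by omega))
  rw [← key, natDegree_C_mul (by simpa using hB0), natDegree_mul hS0 hE] at d1
  omega

lemma aux_linear {K : Type*} [Field K] [CharZero K] (A E B D : K[X])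
    (hA : 0 < A.natDegree) (hd : E.natDegree = A.natDegree) (hB : 0 < B.natDegree)
    (h : B.comp A = D.comp E) : ∃ u v : K, u ≠ 0 ∧ A = C u * E + C v := by
  have hA0 : A ≠ 0 := by rintro rfl; simp at hA
  have hE0 : E ≠ 0 := by rintro rfl; simp at hd; omega
  have hAl : A.leadingCoeff ≠ 0 := by simpa using hA0
  have hEl : E.leadingCoeff ≠ 0 := by simpa using hE0
  set u := A.leadingCoeff / E.leadingCoeff with hu
  have hu0 : u ≠ 0 := div_ne_zero hAl hEl
  have := aux_decomp A (C u * E) B (D.comp (C u⁻¹ * X)) hA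
    (by rw [natDegree_C_mul hu0, hd])
    (by rw [leadingCoeff_mul, leadingCoeff_C, hu, div_mul_cancel₀ _ hEl]) hB
    (by
      rw [h, comp_assoc]
      congr 1
      rw [mul_comp, C_comp, X_comp, ← mul_assoc, ← C_mul, inv_mul_cancel₀ hu0]
      simp)
  rw [natDegree_eq_zero] at this
  obtain ⟨v, hv⟩ := this
  exact ⟨u, v, hu0, by rw [hv]; ring⟩

lemma aux_swap {K : Type*} [Field K] [CharZero K] (A B E D : K[X])
    (hA : 0 < A.natDegree) (hd : E.natDegree = A.natDegree) (hB : 0 < B.natDegree)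
    (h : LinConj (B.comp A) (D.comp E)) : LinConj (A.comp B) (E.comp D) := by
  obtain ⟨l, li, hl, hli, h1, h2, h3⟩ := h
  have hlin : li.natDegree = 1 := natDegree_eq_of_degree_eq_some hli
  have hEd : (E.comp li).natDegree = A.natDegree := by rw [natDegree_comp, hlin, hd, mul_one]
  have h4 : B.comp A = (l.comp D).comp (E.comp li) := by rw [h3]; simp [comp_assoc]
  obtain ⟨u, v, hu, hv⟩ := aux_linear A (E.comp li) B (l.comp D) hA hEd hB h4
  have m1 : (C u * X + C v).comp (C u⁻¹ * X + C (-(u⁻¹ * v))) = X := by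
    simp only [add_comp, mul_comp, C_comp, X_comp, mul_add, ← mul_assoc, ← C_mul]
    simp [hu]
  have m2 : (C u⁻¹ * X + C (-(u⁻¹ * v))).comp (C u * X + C v) = X := by
    simp only [add_comp, mul_comp, C_comp, X_comp, mul_add, ← mul_assoc, ← C_mul]
    simp [hu]
  have hm : A = (C u * X + C v).comp (E.comp li) := by rw [hv]; simp
  have hBm : B.comp (C u * X + C v) = l.comp D := by
    rw [← sub_eq_zero]
    have h5 : (B.comp (C u * X + C v) - l.comp D).comp (E.comp li) = 0 := by
      rw [sub_comp, ← h4, comp_assoc, ← hm, sub_self]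
    rcases comp_eq_zero_iff.mp h5 with h6 | ⟨_, h6⟩
    · exact h6
    · rw [h6, natDegree_C] at hEd; omega
  have hB' : B = (l.comp D).comp (C u⁻¹ * X + C (-(u⁻¹ * v))) := by
    rw [← hBm, comp_assoc, m1, comp_X]
  refine ⟨_, _, degree_linear hu, degree_linear (inv_ne_zero hu), m1, m2, ?_⟩
  have : A.comp B = (C u * X + C v).comp (E.comp ((li.comp l).comp
      (D.comp (C u⁻¹ * X + C (-(u⁻¹ * v)))))) := by
    conv_lhs => rw [hm, hB']
    simp only [comp_assoc]
  rw [this, h2, X_comp]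
  simp only [comp_assoc]

lemma aux_cheb_natDegree {K : Type*} [Field K] [CharZero K] (n : ℕ) :
    (cheb K n).natDegree = n := by
  have h := congrArg natDegree (Chebyshev.C_comp_two_mul_X K n)
  have e : (2 : K[X]) = C 2 := rfl
  rw [natDegree_comp, e, natDegree_C_mul two_ne_zero, natDegree_C_mul two_ne_zero,
    Chebyshev.natDegree_T] at h
  simpa [cheb, dickson_one_one_eq_chebyshev_C] using h

lemma aux_cheb_neg {K : Type*} [Field K] (n : ℕ) (p : K[X]) :
    (cheb K n).comp (-p) = (-1) ^ n * (cheb K n).comp p := by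
  induction n using Nat.twoStepInduction with
  | zero => simp [cheb, dickson_zero]
  | one => simp [cheb]
  | more n h1 h2 =>
    simp only [cheb] at *
    rw [dickson_add_two]
    simp only [sub_comp, mul_comp, X_comp, C_comp, h1, h2]
    ring

lemma aux_cheb_comp {K : Type*} [Field K] (m n : ℕ) :
    cheb K (m * n) = (cheb K m).comp (cheb K n) := dickson_one_one_mul K m n

/-- If `A` and `B` are non-constant polynomials and `A ∘ B` is disintegrated, then `B ∘ A`
is disintegrated. -/
theorem disintegrated_comp_swap {K : Type*} [Field K] [IsAlgClosed K] [CharZero K]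
    (A B : K[X]) (hA : 0 < A.natDegree) (hB : 0 < B.natDegree)
    (h : Disintegrated (A.comp B)) :
    Disintegrated (B.comp A) := by
  obtain ⟨h0, h1, h2, h3⟩ := h
  rw [natDegree_comp] at h0 h1 h2 h3
  unfold Disintegrated
  rw [natDegree_comp]
  refine ⟨by rwa [mul_comm], fun hc => h1 ?_, fun hc => h2 ?_, fun hc => ?_⟩
  · have := aux_swap A B (X ^ A.natDegree) (X ^ B.natDegree) hA (natDegree_X_pow _) hB
      (by simpa [← pow_mul, mul_comm] using hc)
    simpa [← pow_mul, mul_comm] using this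
  · rw [aux_cheb_comp] at hc ⊢
    exact aux_swap A B _ _ hA (aux_cheb_natDegree _) hB hc
  · rw [aux_cheb_comp, ← neg_comp] at hc
    have := aux_swap A B _ _ hA (aux_cheb_natDegree _) hB hc
    rw [aux_cheb_neg, ← aux_cheb_comp] at this
    rcases neg_one_pow_eq_or K[X] A.natDegree with e | e
    · rw [e, one_mul] at this; exact h2 this
    · rw [e, neg_one_mul] at this; exact h3 this
end
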